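/- There exist universal constants c > 0, C > 0 and w₀ such that for every w ≥ w₀, with s = ⌈(ln 2)·2^w⌉ and n = sw, the function Tribes_{w,s} is α-approximately d-resilient with α ≤ C·n^{−1/3} and d = ⌊c·(log n)/(log log n)⌋. -/

import Mathlib

open Finset

noncomputable section

/-- The value `±1` of a bit, with `true ↦ 1` and `false ↦ -1`. -/
def sgn (b : Bool) : ℝ := if b then 1 else -1

/-- Expectation of `f` over a uniformly random point of the hypercube `{-1,1}^ι`. -/
def expect {ι : Type*} [Fintype ι] [DecidableEq ι] (f : (ι → Bool) → ℝ) : ℝ :=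
  (∑ x : ι → Bool, f x) / 2 ^ (Fintype.card ι)

/-- Fourier coefficient `ĝ(S) = E[g(x) ∏_{i ∈ S} x_i]`. -/
def fcoef {ι : Type*} [Fintype ι] [DecidableEq ι] (g : (ι → Bool) → ℝ) (S : Finset ι) : ℝ :=
  expect (fun x => g x * ∏ i ∈ S, sgn (x i))

/-- `g` is `d`-resilient if all its Fourier coefficients of degree at most `d` vanish. -/
def Resilient {ι : Type*} [Fintype ι] [DecidableEq ι] (d : ℕ) (g : (ι → Bool) → ℝ) : Prop :=
  ∀ S : Finset ι, S.card ≤ d → fcoef g S = 0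

/-- `f` is Boolean-valued (takes values in `{-1,1}`). -/
def IsBooleanValued {ι : Type*} (f : (ι → Bool) → ℝ) : Prop := ∀ x, f x = 1 ∨ f x = -1

/-- `g` is bounded (takes values in `[-1,1]`). -/
def IsBounded {ι : Type*} (g : (ι → Bool) → ℝ) : Prop := ∀ x, |g x| ≤ 1

/-- `f` is `α`-approximately `d`-resilient: `f` is `α`-close in `ℓ₁` to a bounded
`d`-resilient function. -/
def ApproxResilient {ι : Type*} [Fintype ι] [DecidableEq ι] (α : ℝ) (d : ℕ)
    (f : (ι → Bool) → ℝ) : Prop :=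
  ∃ g : (ι → Bool) → ℝ, Resilient d g ∧ IsBounded g ∧ expect (fun x => |f x - g x|) ≤ α

/-- The `Tribes_{w,s}` function on `{-1,1}^{sw}` (coordinates indexed by `Fin s × Fin w`,
block `j` being `{(j,i) : i ∈ Fin w}`): the monotone read-once DNF which is `1` iff some block
consists entirely of `1`s (`true`s), and `-1` otherwise. -/
def TribesFun (w s : ℕ) (x : Fin s × Fin w → Bool) : ℝ :=
  if ∃ j : Fin s, ∀ i : Fin w, x (j, i) = true then 1 else -1

theorem exists_annihilator_of_le_dist {X : Type*} [Fintype X]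
    (P : Submodule ℝ (X → ℝ)) (f : X → ℝ) (δ : ℝ)
    (hδ : ∀ p ∈ P, δ ≤ ∑ x, |f x - p x|) :
    ∃ g : X → ℝ, (∀ x, |g x| ≤ 1) ∧ (∀ p ∈ P, ∑ x, g x * p x = 0) ∧ δ ≤ ∑ x, g x * f x := by
  classical
  let e := WithLp.linearEquiv 1 ℝ (X → ℝ)
  let Q : Submodule ℝ (PiLp 1 (fun _ : X => ℝ)) := P.comap e.toLinearMap
  have hQ : IsClosed (Q : Set (PiLp 1 (fun _ : X => ℝ))) := Q.closed_of_finiteDimensional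
  obtain ⟨φ, hφ, hφf⟩ := exists_dual_vector'' ℝ (Q.mkQ (WithLp.toLp 1 f))
  have hφQ : ∀ v : PiLp 1 (fun _ : X => ℝ), |φ (Q.mkQ v)| ≤ ‖v‖ := fun v => by
    calc |φ (Q.mkQ v)| ≤ ‖φ‖ * ‖Q.mkQ v‖ := φ.le_opNorm _
      _ ≤ 1 * ‖v‖ := by
        gcongr
        exact Submodule.Quotient.norm_mk_le Q v
      _ = ‖v‖ := one_mul _
  have hsum : ∀ h : X → ℝ, φ (Q.mkQ (WithLp.toLp 1 h)) =
      ∑ x, φ (Q.mkQ (WithLp.toLp 1 (Pi.single x 1))) * h x := by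
    intro h
    have : (WithLp.toLp 1 h : PiLp 1 (fun _ : X => ℝ)) =
        ∑ x, h x • WithLp.toLp 1 (Pi.single x (1 : ℝ)) := by
      ext y
      simp [Pi.single_apply]
    rw [this]
    simp only [map_sum, map_smul, smul_eq_mul]
    exact Finset.sum_congr rfl fun x _ => mul_comm _ _
  refine ⟨fun x => φ (Q.mkQ (WithLp.toLp 1 (Pi.single x 1))), fun x => ?_, fun p hp => ?_, ?_⟩
  · refine (hφQ _).trans ?_
    simp
  · have h0 : Q.mkQ (WithLp.toLp 1 p) = 0 :=
      (Submodule.Quotient.mk_eq_zero Q).2 (show e (WithLp.toLp 1 p) ∈ P from hp)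
    rw [← hsum, h0, map_zero]
  · rw [← hsum, hφf]
    refine le_of_forall_pos_le_add fun ε hε => ?_
    obtain ⟨m, hm, hmn⟩ := Submodule.Quotient.norm_mk_lt (Q.mkQ (WithLp.toLp 1 f)) hε
    have hm' : WithLp.toLp 1 f - m ∈ Q := by
      rw [← Submodule.Quotient.eq]
      exact hm.symm
    have := hδ _ (show e (WithLp.toLp 1 f - m) ∈ P from hm')
    refine this.trans (le_trans (le_of_eq ?_) hmn.le)
    rw [PiLp.norm_eq_of_nat 1 (by simp)]
    simp [e]

theorem sgn_mul_self (b : Bool) : sgn b * sgn b = 1 := by cases b <;> simp [sgn]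

theorem sgn_not (b : Bool) : sgn (!b) = -sgn b := by cases b <;> simp [sgn]

section LowDegree

variable {ι : Type*} [DecidableEq ι]

/-- The function `F` does not depend on the `i`-th coordinate. -/
def IndepOfCoord (i : ι) (F : (ι → Bool) → ℝ) : Prop :=
  ∀ x, F (Function.update x i (!x i)) = F x

/-- The multilinear polynomial in the variables `T` of degree at most `d` with
coefficients `a`. -/
def lowDegreePoly (T : Finset ι) (d : ℕ) (a : Finset ι → ℝ) (x : ι → Bool) : ℝ :=
  ∑ S ∈ T.powerset with S.card ≤ d, a S * ∏ i ∈ S, sgn (x i)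

theorem indepOfCoord_lowDegreePoly {T : Finset ι} {i : ι} (hi : i ∉ T) (d : ℕ)
    (a : Finset ι → ℝ) : IndepOfCoord i (lowDegreePoly T d a) := by
  intro x
  refine Finset.sum_congr rfl fun S hS => ?_
  congr 1
  refine Finset.prod_congr rfl fun j hj => ?_
  have hjT : j ∈ T := Finset.mem_powerset.1 (Finset.mem_filter.1 hS).1 hj
  rw [Function.update_of_ne (by rintro rfl; exact hi hjT)]

theorem lowDegreePoly_empty {κ : Type*} (d : ℕ) (a : Finset κ → ℝ) (x : κ → Bool) :
    lowDegreePoly ∅ d a x = a ∅ := by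
  simp [lowDegreePoly, Finset.filter_singleton]

theorem filter_powerset_card_le_zero {κ : Type*} (T : Finset κ) :
    (T.powerset.filter fun S => S.card ≤ 0) = {∅} := by
  ext S
  simp only [Finset.mem_filter, Finset.mem_powerset, Nat.le_zero, Finset.card_eq_zero,
    Finset.mem_singleton]
  exact ⟨fun h => h.2, fun h => ⟨by simp [h], h⟩⟩

theorem lowDegreePoly_zero {κ : Type*} (T : Finset κ) (a : Finset κ → ℝ) (x : κ → Bool) :
    lowDegreePoly T 0 a x = a ∅ := by
  simp only [lowDegreePoly, filter_powerset_card_le_zero, Finset.sum_singleton,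
    Finset.prod_empty, mul_one]

theorem sum_powerset_insert_card_le {T : Finset ι} {i : ι} (hi : i ∉ T) (d : ℕ)
    (b : Finset ι → ℝ) :
    ∑ S ∈ (insert i T).powerset with S.card ≤ d + 1, b S =
      ∑ S ∈ T.powerset with S.card ≤ d + 1, b S +
        ∑ S ∈ T.powerset with S.card ≤ d, b (insert i S) := by
  simp only [Finset.sum_filter]
  rw [Finset.sum_powerset_insert hi]
  congr 1
  refine Finset.sum_congr rfl fun S hS => ?_
  rw [Finset.card_insert_of_notMem fun h => hi (Finset.mem_powerset.1 hS h)]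
  simp

theorem lowDegreePoly_insert {T : Finset ι} {i : ι} (hi : i ∉ T) (d : ℕ)
    (a : Finset ι → ℝ) (x : ι → Bool) :
    lowDegreePoly (insert i T) (d + 1) a x = lowDegreePoly T (d + 1) a x +
      sgn (x i) * lowDegreePoly T d (fun S => a (insert i S)) x := by
  unfold lowDegreePoly
  rw [sum_powerset_insert_card_le hi, Finset.mul_sum]
  congr 1
  refine Finset.sum_congr rfl fun S hS => ?_
  rw [Finset.prod_insert fun h => hi (Finset.mem_powerset.1 (Finset.mem_filter.1 hS).1 h)]
  ring

end LowDegree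

section Hypercube

variable {ι : Type*} [Fintype ι] [DecidableEq ι]

theorem cubeExpect_add (f g : (ι → Bool) → ℝ) :
    _root_.expect (fun x => f x + g x) = _root_.expect f + _root_.expect g := by
  simp [_root_.expect, Finset.sum_add_distrib, add_div]

theorem cubeExpect_sub (f g : (ι → Bool) → ℝ) :
    _root_.expect (fun x => f x - g x) = _root_.expect f - _root_.expect g := by
  simp [_root_.expect, Finset.sum_sub_distrib, sub_div]

theorem cubeExpect_const_mul (c : ℝ) (f : (ι → Bool) → ℝ) :
    _root_.expect (fun x => c * f x) = c * _root_.expect f := by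
  simp [_root_.expect, Finset.mul_sum, mul_div_assoc, Finset.sum_div]

theorem cubeExpect_const (c : ℝ) : _root_.expect (fun _ : ι → Bool => c) = c := by
  simp [_root_.expect]

theorem cubeExpect_mono {f g : (ι → Bool) → ℝ} (h : ∀ x, f x ≤ g x) :
    _root_.expect f ≤ _root_.expect g := by
  unfold _root_.expect
  gcongr
  exact h _

theorem cubeExpect_nonneg {f : (ι → Bool) → ℝ} (h : ∀ x, 0 ≤ f x) : 0 ≤ _root_.expect f :=
  div_nonneg (Finset.sum_nonneg fun x _ => h x) (by positivity)

theorem cubeExpect_sum {κ : Type*} (s : Finset κ) (f : κ → (ι → Bool) → ℝ) :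
    _root_.expect (fun x => ∑ k ∈ s, f k x) = ∑ k ∈ s, _root_.expect (f k) := by
  simp only [_root_.expect, ← Finset.sum_div]
  rw [Finset.sum_comm]

theorem cubeExpect_sq_le {f g r : (ι → Bool) → ℝ} (hf : ∀ x, 0 ≤ f x) (hg : ∀ x, 0 ≤ g x)
    (hr : ∀ x, r x ^ 2 = f x * g x) :
    _root_.expect r ^ 2 ≤ _root_.expect f * _root_.expect g := by
  unfold _root_.expect
  rw [div_pow, div_mul_div_comm, ← sq]
  gcongr
  exact Finset.sum_sq_le_sum_mul_sum_of_sq_le_mul _ (fun x _ => hf x) (fun x _ => hg x)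
    fun x _ => (hr x).le

theorem cubeExpect_sgn_mul {i : ι} {F : (ι → Bool) → ℝ} (hF : IndepOfCoord i F) :
    _root_.expect (fun x => sgn (x i) * F x) = 0 := by
  have hinv : Function.Involutive fun x : ι → Bool => Function.update x i (!x i) := by
    intro x
    simp
  have h := Equiv.sum_comp hinv.toPerm fun x => sgn (x i) * F x
  simp only [Function.Involutive.coe_toPerm, hF _, Function.update_self, sgn_not, neg_mul,
    Finset.sum_neg_distrib] at h
  have : ∑ x : ι → Bool, sgn (x i) * F x = 0 := by linarith
  simp [_root_.expect, this]

theorem cubeExpect_prod_sgn (S : Finset ι) :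
    _root_.expect (fun x : ι → Bool => ∏ i ∈ S, sgn (x i)) = if S = ∅ then 1 else 0 := by
  split_ifs with h
  · simp [h, cubeExpect_const]
  · obtain ⟨i, hi⟩ := Finset.nonempty_iff_ne_empty.2 h
    have h1 : ∀ x : ι → Bool,
        ∏ i ∈ S, sgn (x i) = sgn (x i) * ∏ j ∈ S.erase i, sgn (x j) :=
      fun x => (Finset.mul_prod_erase S (fun j => sgn (x j)) hi).symm
    simp only [h1]
    refine cubeExpect_sgn_mul fun x => Finset.prod_congr rfl fun j hj => ?_
    rw [Function.update_of_ne (Finset.ne_of_mem_erase hj)]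

theorem cubeExpect_sq_add_sgn_mul {i : ι} {q r : (ι → Bool) → ℝ} (hq : IndepOfCoord i q)
    (hr : IndepOfCoord i r) :
    _root_.expect (fun x => (q x + sgn (x i) * r x) ^ 2) =
      _root_.expect (fun x => q x ^ 2) + _root_.expect (fun x => r x ^ 2) := by
  have h0 : _root_.expect (fun x => sgn (x i) * (2 * q x * r x)) = 0 :=
    cubeExpect_sgn_mul fun x => by rw [hq x, hr x]
  have h1 : (fun x => (q x + sgn (x i) * r x) ^ 2) =
      fun x => (q x ^ 2 + r x ^ 2) + sgn (x i) * (2 * q x * r x) := by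
    funext x
    linear_combination r x ^ 2 * sgn_mul_self (x i)
  rw [h1, cubeExpect_add, cubeExpect_add, h0, add_zero]

theorem cubeExpect_pow_four_add_sgn_mul {i : ι} {q r : (ι → Bool) → ℝ} (hq : IndepOfCoord i q)
    (hr : IndepOfCoord i r) :
    _root_.expect (fun x => (q x + sgn (x i) * r x) ^ 4) =
      _root_.expect (fun x => q x ^ 4) + 6 * _root_.expect (fun x => q x ^ 2 * r x ^ 2) +
        _root_.expect (fun x => r x ^ 4) := by
  have h0 : _root_.expect (fun x => sgn (x i) * (4 * q x ^ 3 * r x + 4 * q x * r x ^ 3)) = 0 :=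
    cubeExpect_sgn_mul fun x => by rw [hq x, hr x]
  have h1 : (fun x => (q x + sgn (x i) * r x) ^ 4) =
      fun x => (q x ^ 4 + 6 * (q x ^ 2 * r x ^ 2) + r x ^ 4) +
        sgn (x i) * (4 * q x ^ 3 * r x + 4 * q x * r x ^ 3) := by
    funext x
    linear_combination (6 * q x ^ 2 * r x ^ 2 + 4 * q x * r x ^ 3 * sgn (x i) +
      r x ^ 4 * (sgn (x i) * sgn (x i) + 1)) * sgn_mul_self (x i)
  rw [h1, cubeExpect_add, cubeExpect_add, cubeExpect_add, cubeExpect_const_mul, h0, add_zero]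

/-- Parseval's identity for low-degree polynomials. -/
theorem cubeExpect_lowDegreePoly_sq (T : Finset ι) (d : ℕ) (a : Finset ι → ℝ) :
    _root_.expect (fun x => lowDegreePoly T d a x ^ 2) =
      ∑ S ∈ T.powerset with S.card ≤ d, a S ^ 2 := by
  induction T using Finset.induction_on generalizing d a with
  | empty => simp [lowDegreePoly_empty, cubeExpect_const, Finset.filter_singleton]
  | insert i T hi ih =>
    cases d with
    | zero =>
      simp only [lowDegreePoly_zero, cubeExpect_const, filter_powerset_card_le_zero, Finset.sum_singleton]
    | succ d =>
      simp only [lowDegreePoly_insert hi]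
      rw [cubeExpect_sq_add_sgn_mul (indepOfCoord_lowDegreePoly hi _ _)
        (indepOfCoord_lowDegreePoly hi _ _), ih, ih, sum_powerset_insert_card_le hi]

/-- Bonami's lemma. -/
theorem cubeExpect_lowDegreePoly_pow_four_le (T : Finset ι) (d : ℕ) (a : Finset ι → ℝ) :
    _root_.expect (fun x => lowDegreePoly T d a x ^ 4) ≤
      9 ^ d * _root_.expect (fun x => lowDegreePoly T d a x ^ 2) ^ 2 := by
  induction T using Finset.induction_on generalizing d a with
  | empty =>
    simp only [lowDegreePoly_empty, cubeExpect_const]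
    have : (1 : ℝ) ≤ 9 ^ d := one_le_pow₀ (by norm_num)
    nlinarith [sq_nonneg (a ∅ ^ 2)]
  | insert i T hi ih =>
    cases d with
    | zero =>
      simp only [lowDegreePoly_zero, cubeExpect_const]
      exact le_of_eq (by ring)
    | succ d =>
      simp only [lowDegreePoly_insert hi]
      rw [cubeExpect_sq_add_sgn_mul (indepOfCoord_lowDegreePoly hi _ _)
        (indepOfCoord_lowDegreePoly hi _ _),
        cubeExpect_pow_four_add_sgn_mul (indepOfCoord_lowDegreePoly hi _ _)
        (indepOfCoord_lowDegreePoly hi _ _)]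
      have hq := ih (d + 1) a
      have hr := ih d fun S => a (insert i S)
      set q := lowDegreePoly T (d + 1) a
      set r := lowDegreePoly T d fun S => a (insert i S)
      have hA : 0 ≤ _root_.expect fun x => q x ^ 2 := cubeExpect_nonneg fun x => sq_nonneg _
      have hB : 0 ≤ _root_.expect fun x => r x ^ 2 := cubeExpect_nonneg fun x => sq_nonneg _
      have hr4 : 0 ≤ _root_.expect fun x => r x ^ 4 := cubeExpect_nonneg fun x => by positivity
      have hqr : _root_.expect (fun x => q x ^ 2 * r x ^ 2) ^ 2 ≤
          _root_.expect (fun x => q x ^ 4) * _root_.expect (fun x => r x ^ 4) :=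
        cubeExpect_sq_le (fun x => by positivity) (fun x => by positivity) fun x => by ring
      set A := _root_.expect fun x => q x ^ 2
      set B := _root_.expect fun x => r x ^ 2
      have hM : _root_.expect (fun x => q x ^ 2 * r x ^ 2) ≤ 3 * 9 ^ d * (A * B) := by
        refine le_of_pow_le_pow_left₀ two_ne_zero (by positivity) ?_
        calc _ ≤ _ := hqr
          _ ≤ (9 ^ (d + 1) * A ^ 2) * (9 ^ d * B ^ 2) := by gcongr
          _ = (3 * 9 ^ d * (A * B)) ^ 2 := by ring
      have h9 : (0 : ℝ) ≤ 9 ^ d * B ^ 2 := by positivity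
      calc _ ≤ 9 ^ (d + 1) * A ^ 2 + 6 * (3 * 9 ^ d * (A * B)) + 9 ^ d * B ^ 2 := by gcongr
        _ ≤ 9 ^ (d + 1) * (A + B) ^ 2 := by
          rw [pow_succ]
          linarith

/-- A low-degree polynomial has comparable first and second moments. -/
theorem cubeExpect_lowDegreePoly_sq_le (T : Finset ι) (d : ℕ) (a : Finset ι → ℝ) :
    _root_.expect (fun x => lowDegreePoly T d a x ^ 2) ≤
      9 ^ d * _root_.expect (fun x => |lowDegreePoly T d a x|) ^ 2 := by
  have h4 := cubeExpect_lowDegreePoly_pow_four_le T d a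
  set p := lowDegreePoly T d a
  have h12 : _root_.expect (fun x => p x ^ 2) ^ 2 ≤
      _root_.expect (fun x => |p x|) * _root_.expect (fun x => |p x| ^ 3) :=
    cubeExpect_sq_le (fun x => abs_nonneg _) (fun x => by positivity) fun x => by
      rw [← sq_abs (p x)]; ring
  have h24 : _root_.expect (fun x => |p x| ^ 3) ^ 2 ≤
      _root_.expect (fun x => p x ^ 2) * _root_.expect (fun x => p x ^ 4) :=
    cubeExpect_sq_le (fun x => sq_nonneg _) (fun x => by positivity) fun x => by
      rw [← pow_mul, mul_comm, pow_mul, sq_abs]; ring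
  have h1 : 0 ≤ _root_.expect fun x => |p x| := cubeExpect_nonneg fun x => abs_nonneg _
  have h3 : 0 ≤ _root_.expect fun x => |p x| ^ 3 := cubeExpect_nonneg fun x => by positivity
  have h2 : 0 ≤ _root_.expect fun x => p x ^ 2 := cubeExpect_nonneg fun x => sq_nonneg _
  set A := _root_.expect fun x => |p x|
  set B := _root_.expect fun x => p x ^ 2
  rcases h2.eq_or_lt with hB | hB
  · rw [← hB]; positivity
  · have key : B * B ^ 3 ≤ (9 ^ d * A ^ 2) * B ^ 3 := by
      calc B * B ^ 3 = (B ^ 2) ^ 2 := by ring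
        _ ≤ (A * _root_.expect fun x => |p x| ^ 3) ^ 2 := by gcongr
        _ = A ^ 2 * (_root_.expect fun x => |p x| ^ 3) ^ 2 := by ring
        _ ≤ A ^ 2 * (B * (9 ^ d * B ^ 2)) := by
          gcongr
          exact h24.trans (by gcongr)
        _ = (9 ^ d * A ^ 2) * B ^ 3 := by ring
    exact le_of_mul_le_mul_right key (by positivity)

theorem cubeExpect_mul_lowDegreePoly_sq_le (f : (ι → Bool) → ℝ) (d : ℕ) (a : Finset ι → ℝ) :
    _root_.expect (fun x => f x * lowDegreePoly univ d a x) ^ 2 ≤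
      _root_.expect (fun x => lowDegreePoly univ d a x ^ 2) *
        ∑ S : Finset ι with S.card ≤ d, fcoef f S ^ 2 := by
  have h : _root_.expect (fun x => f x * lowDegreePoly univ d a x) =
      ∑ S : Finset ι with S.card ≤ d, a S * fcoef f S := by
    simp only [lowDegreePoly, Finset.mul_sum, Finset.powerset_univ]
    rw [cubeExpect_sum]
    refine Finset.sum_congr rfl fun S _ => ?_
    rw [fcoef, ← cubeExpect_const_mul]
    congr 1
    funext x
    ring
  rw [h, cubeExpect_lowDegreePoly_sq, Finset.powerset_univ]
  exact Finset.sum_mul_sq_le_sq_mul_sq _ _ _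

/-- A Boolean function with small Fourier weight on low degrees is approximately resilient. -/
theorem approxResilient_of_lowDegreeWeight_le {f : (ι → Bool) → ℝ} (hf : IsBooleanValued f)
    {d : ℕ} {α : ℝ} (hα : 0 ≤ α)
    (hW : 4 * 9 ^ d * ∑ S : Finset ι with S.card ≤ d, fcoef f S ^ 2 ≤ α ^ 2) :
    ApproxResilient α d f := by
  have hfabs : ∀ x, |f x| = 1 := fun x => by rcases hf x with h | h <;> simp [h]
  have hfsq : ∀ x, f x * f x = 1 := fun x => by rcases hf x with h | h <;> simp [h]
  have hdist : ∀ a : Finset ι → ℝ,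
      1 - α ≤ _root_.expect fun x => |f x - lowDegreePoly univ d a x| := by
    intro a
    set p := lowDegreePoly univ d a with hp
    by_cases h2 : 2 ≤ _root_.expect fun x => |p x|
    · have : _root_.expect (fun x => |p x| - 1) ≤ _root_.expect fun x => |f x - p x| :=
        cubeExpect_mono fun x => by
          have := abs_sub_abs_le_abs_sub (p x) (f x)
          rw [hfabs, abs_sub_comm] at this
          exact this
      rw [cubeExpect_sub, cubeExpect_const] at this
      linarith
    · have h1 : _root_.expect (fun x => 1 - f x * p x) ≤ _root_.expect fun x => |f x - p x| :=
        cubeExpect_mono fun x => by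
          calc 1 - f x * p x = f x * (f x - p x) := by rw [mul_sub, hfsq]
            _ ≤ |f x * (f x - p x)| := le_abs_self _
            _ = |f x - p x| := by rw [abs_mul, hfabs, one_mul]
      rw [cubeExpect_sub, cubeExpect_const] at h1
      have h3 : _root_.expect (fun x => f x * p x) ≤ α := by
        refine le_of_pow_le_pow_left₀ two_ne_zero hα ?_
        refine (cubeExpect_mul_lowDegreePoly_sq_le f d a).trans (le_trans ?_ hW)
        have h4 := cubeExpect_lowDegreePoly_sq_le univ d a
        rw [← hp] at h4 ⊢
        have h5 : 0 ≤ _root_.expect fun x => |p x| := cubeExpect_nonneg fun x => abs_nonneg _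
        have h6 : (0 : ℝ) < 9 ^ d := by positivity
        gcongr
        push Not at h2
        have h7 : _root_.expect (fun x => |p x|) ^ 2 ≤ 4 := by nlinarith
        calc _root_.expect (fun x => p x ^ 2) ≤ 9 ^ d * _root_.expect (fun x => |p x|) ^ 2 := h4
          _ ≤ 9 ^ d * 4 := by gcongr
          _ = 4 * 9 ^ d := mul_comm _ _
      linarith
  let χ : Finset ι → (ι → Bool) → ℝ := fun S x => ∏ i ∈ S, sgn (x i)
  let D : Finset (Finset ι) := univ.filter fun S => S.card ≤ d
  have hN : (0 : ℝ) < 2 ^ Fintype.card ι := by positivity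
  obtain ⟨g, hg1, hgP, hgf⟩ := exists_annihilator_of_le_dist (Submodule.span ℝ (χ '' D)) f
    ((1 - α) * 2 ^ Fintype.card ι) (by
      intro p hp
      obtain ⟨a, rfl⟩ := (Submodule.mem_span_image_finset_iff_exists_fun' ℝ).1 hp
      have := hdist a
      rw [_root_.expect, le_div_iff₀ hN] at this
      refine this.trans (le_of_eq (Finset.sum_congr rfl fun x _ => ?_))
      simp [lowDegreePoly, Finset.sum_apply, χ, D])
  refine ⟨g, fun S hS => ?_, hg1, ?_⟩
  · have := hgP (χ S) (Submodule.subset_span ⟨S, by simpa [D] using hS, rfl⟩)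
    simp only [fcoef, _root_.expect]
    rw [div_eq_zero_iff]
    exact Or.inl this
  · have h1 : ∀ x, |f x - g x| = 1 - g x * f x := fun x => by
      have := abs_le.1 (hg1 x)
      rcases hf x with h | h
      · rw [h, abs_of_nonneg (by linarith)]; ring
      · rw [h, abs_of_nonpos (by linarith)]; ring
    simp only [h1]
    rw [cubeExpect_sub, cubeExpect_const]
    have : 1 - α ≤ _root_.expect fun x => g x * f x := by
      rw [_root_.expect, le_div_iff₀ hN]
      exact hgf
    linarith

end Hypercube

section Blocks

theorem fcoef_one_sub_and {w : ℕ} (S : Finset (Fin w)) :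
    fcoef (fun y : Fin w → Bool => 1 - if ∀ i, y i = true then 1 else 0) S =
      (if S = ∅ then 1 else 0) - (1 / 2) ^ w := by
  have h1 : _root_.expect (fun y : Fin w → Bool =>
      (if ∀ i, y i = true then 1 else 0) * ∏ i ∈ S, sgn (y i)) = (1 / 2) ^ w := by
    unfold _root_.expect
    rw [Finset.sum_eq_single fun _ => true]
    · simp [sgn]
    · intro y _ hy
      rw [if_neg fun h => hy (funext h), zero_mul]
    · simp
  rw [← cubeExpect_prod_sgn, ← h1, ← cubeExpect_sub, fcoef]
  congr 1
  funext y
  ring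

/-- The part of `S` lying in the `j`-th block. -/
def blockSlice {s w : ℕ} (S : Finset (Fin s × Fin w)) (j : Fin s) : Finset (Fin w) :=
  univ.filter fun i => (j, i) ∈ S

theorem prod_eq_prod_blockSlice {s w : ℕ} (S : Finset (Fin s × Fin w))
    {M : Type*} [CommMonoid M] (g : Fin s × Fin w → M) :
    ∏ p ∈ S, g p = ∏ j, ∏ i ∈ blockSlice S j, g (j, i) := by
  simp only [blockSlice, Finset.prod_filter]
  rw [← Finset.prod_product' (f := fun j i => if (j, i) ∈ S then g (j, i) else 1),
    Finset.univ_product_univ, ← Finset.prod_filter]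
  simp

/-- A subset of a union of blocks is the same as a family of subsets of the blocks. -/
def blockSliceEquiv (s w : ℕ) : Finset (Fin s × Fin w) ≃ (Fin s → Finset (Fin w)) where
  toFun := blockSlice
  invFun T := univ.filter fun p => p.2 ∈ T p.1
  left_inv S := by ext; simp [blockSlice]
  right_inv T := by ext; simp [blockSlice]

theorem fcoef_prod_blocks {s w : ℕ} (h : (Fin w → Bool) → ℝ) (S : Finset (Fin s × Fin w)) :
    fcoef (fun x => ∏ j, h fun i => x (j, i)) S = ∏ j, fcoef h (blockSlice S j) := by
  simp only [fcoef, _root_.expect, Finset.prod_div_distrib, Finset.prod_const, Finset.card_univ,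
    Fintype.card_prod, Fintype.card_fin]
  rw [← pow_mul, mul_comm w s]
  congr 1
  rw [Finset.prod_univ_sum, Fintype.piFinset_univ,
    ← Equiv.sum_comp (Equiv.curry (Fin s) (Fin w) Bool)]
  refine Finset.sum_congr rfl fun x _ => ?_
  rw [prod_eq_prod_blockSlice, ← Finset.prod_mul_distrib]
  rfl

theorem sum_prod_blockSlice {s w : ℕ} (φ : Finset (Fin w) → ℝ) :
    ∑ S : Finset (Fin s × Fin w), ∏ j, φ (blockSlice S j) = (∑ T, φ T) ^ s := by
  have := Equiv.sum_comp (blockSliceEquiv s w) fun T => ∏ j, φ (T j)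
  have h2 := Finset.prod_univ_sum (fun _ : Fin s => (univ : Finset (Finset (Fin w))))
    fun _ T => φ T
  rw [Fintype.piFinset_univ] at h2
  rw [Finset.prod_const, Finset.card_fin] at h2
  rw [h2, ← this]
  rfl

theorem tribesFun_eq (w s : ℕ) (x : Fin s × Fin w → Bool) :
    TribesFun w s x =
      1 - 2 * ∏ j, (1 - if ∀ i, x (j, i) = true then (1 : ℝ) else 0) := by
  unfold TribesFun
  split_ifs with h
  · obtain ⟨j, hj⟩ := h
    rw [Finset.prod_eq_zero (Finset.mem_univ j) (by simp [hj])]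
    ring
  · push Not at h
    rw [Finset.prod_eq_one fun j _ => ?_]
    · ring
    · obtain ⟨i, hi⟩ := h j
      rw [if_neg fun h => hi (h i), sub_zero]

theorem fcoef_tribesFun (w s : ℕ) (S : Finset (Fin s × Fin w)) :
    fcoef (TribesFun w s) S = (if S = ∅ then 1 else 0) -
      2 * ∏ j, ((if blockSlice S j = ∅ then 1 else 0) - (1 / 2) ^ w) := by
  have h1 := fcoef_prod_blocks
    (fun y : Fin w → Bool => 1 - if ∀ i, y i = true then (1 : ℝ) else 0) S
  simp only [fcoef_one_sub_and] at h1
  rw [← h1, ← cubeExpect_prod_sgn, fcoef, fcoef, ← cubeExpect_const_mul, ← cubeExpect_sub]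
  congr 1
  funext x
  rw [tribesFun_eq]
  ring

theorem pow_sub_pow_le_mul_sub {a b : ℝ} (hb : 0 ≤ b) (hab : b ≤ a) (ha : a ≤ 1) (n : ℕ) :
    a ^ n - b ^ n ≤ n * (a - b) := by
  induction n with
  | zero => simp
  | succ n ih =>
    have h1 : b ^ n ≤ 1 := pow_le_one₀ hb (hab.trans ha)
    have h2 : b ^ n ≤ a ^ n := by gcongr
    rw [pow_succ, pow_succ]
    push_cast
    nlinarith [mul_le_mul_of_nonneg_right h1 (sub_nonneg.2 hab),
      mul_le_mul_of_nonneg_left ha (sub_nonneg.2 h2)]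

theorem sum_pow_card_mul_sq {w : ℕ} (t x : ℝ) :
    ∑ T : Finset (Fin w), t ^ T.card * ((if T = ∅ then 1 else 0) - x) ^ 2 =
      (1 - x) ^ 2 + x ^ 2 * ((1 + t) ^ w - 1) := by
  have h1 : ∀ T : Finset (Fin w), t ^ T.card * ((if T = ∅ then 1 else 0) - x) ^ 2 =
      (if T = ∅ then 1 - 2 * x else 0) + x ^ 2 * (t ^ T.card * 1 ^ (w - T.card)) := by
    intro T
    split_ifs with h
    · simp [h]; ring
    · simp; ring
  have h2 := Fintype.sum_pow_mul_eq_add_pow (Fin w) t 1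
  rw [Fintype.card_fin] at h2
  simp only [h1]
  rw [Finset.sum_add_distrib, ← Finset.mul_sum, h2, Finset.sum_ite_eq']
  simp only [Finset.mem_univ, if_true]
  ring

theorem blockSlice_eq_empty {s w : ℕ} {S : Finset (Fin s × Fin w)} :
    (∀ j, blockSlice S j = ∅) ↔ S = ∅ := by
  refine ⟨fun h => Finset.eq_empty_of_forall_notMem fun p hp => ?_, fun h => ?_⟩
  · have : p.2 ∈ blockSlice S p.1 := by simpa [blockSlice] using hp
    simp [h] at this
  · simp [h, blockSlice]

theorem lowDegreeWeight_tribesFun_le {w s : ℕ} (hw : 1 ≤ w) (d : ℕ)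
    (hs : (s : ℝ) * (1 / 2) ^ w ≤ 1) :
    ∑ S : Finset (Fin s × Fin w) with S.card ≤ d, fcoef (TribesFun w s) S ^ 2 ≤
      (1 - 2 * (1 - (1 / 2) ^ w) ^ s) ^ 2 + 8 * w ^ d * (1 / 2) ^ w := by
  set x : ℝ := (1 / 2) ^ w with hx
  have hx0 : 0 < x := by positivity
  have hx1 : x ≤ 1 / 2 :=
    pow_le_of_le_one (by norm_num) (by norm_num) (by omega)
  have hw0 : (1 : ℝ) ≤ w := by exact_mod_cast hw
  set t : ℝ := 1 / w with ht
  have ht0 : 0 < t := by positivity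
  have htw : w * t = 1 := by rw [ht]; field_simp
  set c : Finset (Fin w) → ℝ := fun T => (if T = ∅ then 1 else 0) - x with hc
  set v : Finset (Fin s × Fin w) → ℝ :=
    fun S => ∏ j, (t ^ (blockSlice S j).card * c (blockSlice S j) ^ 2) with hv
  have hv0 : ∀ S, 0 ≤ v S := fun S => Finset.prod_nonneg fun j _ => by positivity
  have hvS : ∀ S, v S = t ^ S.card * (∏ j, c (blockSlice S j)) ^ 2 := fun S => by
    rw [hv]
    simp only
    rw [Finset.prod_mul_distrib, Finset.prod_pow, Finset.prod_pow_eq_pow_sum]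
    congr 2
    have := prod_eq_prod_blockSlice S (M := Multiplicative ℕ) fun _ => Multiplicative.ofAdd 1
    rw [Finset.card_eq_sum_ones]
    simp only [Finset.card_eq_sum_ones]
    exact this.symm
  have hG : ∑ S, v S = ((1 - x) ^ 2 + x ^ 2 * ((1 + t) ^ w - 1)) ^ s := by
    rw [← sum_pow_card_mul_sq t x, ← sum_prod_blockSlice]
  have hvempty : v ∅ = ((1 - x) ^ 2) ^ s := by
    simp [hv, hc, blockSlice]
  have hexp : (1 + t) ^ w ≤ 3 := by
    calc (1 + t) ^ w ≤ (Real.exp t) ^ w := by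
          gcongr
          linarith [Real.add_one_le_exp t]
      _ = Real.exp 1 := by rw [← Real.exp_nat_mul, htw]
      _ ≤ 3 := by linarith [Real.exp_one_lt_d9]
  have hexp1 : 1 ≤ (1 + t) ^ w := one_le_pow₀ (by linarith)
  have hrest : ∑ S ∈ univ.erase ∅, v S ≤ 2 * x := by
    have h1 := Finset.add_sum_erase univ v (Finset.mem_univ ∅)
    rw [hG, hvempty] at h1
    have h2 := pow_sub_pow_le_mul_sub (sq_nonneg (1 - x))
      (le_add_of_nonneg_right (by nlinarith [sq_nonneg x]) :
        (1 - x) ^ 2 ≤ (1 - x) ^ 2 + x ^ 2 * ((1 + t) ^ w - 1))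
      (by nlinarith [mul_le_mul_of_nonneg_left hexp (sq_nonneg x)]) s
    have h3 : (s : ℝ) * ((1 - x) ^ 2 + x ^ 2 * ((1 + t) ^ w - 1) - (1 - x) ^ 2) ≤ 2 * x := by
      calc (s : ℝ) * ((1 - x) ^ 2 + x ^ 2 * ((1 + t) ^ w - 1) - (1 - x) ^ 2)
          = (s * x) * (x * ((1 + t) ^ w - 1)) := by ring
        _ ≤ 1 * (x * (3 - 1)) := by gcongr
        _ = 2 * x := by ring
    linarith
  have hterm : ∀ S ∈ (univ.filter fun S : Finset (Fin s × Fin w) => S.card ≤ d).erase ∅,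
      fcoef (TribesFun w s) S ^ 2 ≤ 4 * w ^ d * v S := by
    intro S hS
    obtain ⟨hne, hcard⟩ := Finset.mem_erase.1 hS
    have hcard : S.card ≤ d := (Finset.mem_filter.1 hcard).2
    rw [fcoef_tribesFun, if_neg hne, hvS, ← hx]
    have h1 : 1 ≤ (w : ℝ) ^ d * t ^ S.card := by
      calc (1 : ℝ) = (w * t) ^ S.card := by rw [htw, one_pow]
        _ = (w : ℝ) ^ S.card * t ^ S.card := mul_pow _ _ _
        _ ≤ (w : ℝ) ^ d * t ^ S.card := by gcongr
    have h2 : 0 ≤ (∏ j, c (blockSlice S j)) ^ 2 := sq_nonneg _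
    calc (0 - 2 * ∏ j, c (blockSlice S j)) ^ 2 = 4 * (1 * (∏ j, c (blockSlice S j)) ^ 2) := by ring
      _ ≤ 4 * ((w : ℝ) ^ d * t ^ S.card * (∏ j, c (blockSlice S j)) ^ 2) := by gcongr
      _ = _ := by ring
  rw [← Finset.add_sum_erase _ _ (by simp : ∅ ∈ univ.filter fun S : Finset (Fin s × Fin w) =>
    S.card ≤ d)]
  have hempty : fcoef (TribesFun w s) ∅ = 1 - 2 * (1 - x) ^ s := by
    rw [fcoef_tribesFun, ← hx]
    simp [blockSlice]
  rw [hempty]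
  gcongr
  calc _ ≤ ∑ S ∈ (univ.filter fun S : Finset (Fin s × Fin w) => S.card ≤ d).erase ∅,
        4 * w ^ d * v S := Finset.sum_le_sum hterm
    _ ≤ ∑ S ∈ univ.erase ∅, 4 * w ^ d * v S :=
        Finset.sum_le_sum_of_subset_of_nonneg
          (Finset.erase_subset_erase _ (Finset.filter_subset _ _))
          fun S _ _ => mul_nonneg (by positivity) (hv0 S)
    _ = 4 * w ^ d * ∑ S ∈ univ.erase ∅, v S := by rw [Finset.mul_sum]
    _ ≤ 4 * w ^ d * (2 * x) := by gcongr
    _ = 8 * w ^ d * x := by ring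

/-- The Tribes function with `s = ⌈ln 2 · 2^w⌉` blocks is nearly balanced. -/
theorem one_sub_two_mul_pow_sq_le {x : ℝ} (hx0 : 0 < x) (hx1 : x ≤ 1 / 2) {s : ℕ}
    (hs : Real.log 2 ≤ s * x) (hs' : s * x ≤ Real.log 2 + x) :
    (1 - 2 * (1 - x) ^ s) ^ 2 ≤ 16 * x := by
  have hlog := Real.log_two_lt_d9
  have hhalf : Real.exp (-Real.log 2) = 1 / 2 := by
    rw [Real.exp_neg, Real.exp_log two_pos]; norm_num
  have hup : (1 - x) ^ s ≤ 1 / 2 := by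
    calc (1 - x) ^ s ≤ (Real.exp (-x)) ^ s := by
          gcongr
          · linarith
          · exact Real.one_sub_le_exp_neg x
      _ = Real.exp (-(s * x)) := by rw [← Real.exp_nat_mul]; ring_nf
      _ ≤ Real.exp (-Real.log 2) := by gcongr
      _ = 1 / 2 := hhalf
  have hbase : Real.exp (-(x + 2 * x ^ 2)) ≤ 1 - x := by
    rw [Real.exp_neg, inv_le_iff_one_le_mul₀ (Real.exp_pos _)]
    have := Real.add_one_le_exp (x + 2 * x ^ 2)
    calc (1 : ℝ) ≤ (1 - x) * (x + 2 * x ^ 2 + 1) := by nlinarith [sq_nonneg x]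
      _ ≤ (1 - x) * Real.exp (x + 2 * x ^ 2) := by
        gcongr
        linarith
  have hlow : 1 / 2 * (1 - 4 * x) ≤ (1 - x) ^ s := by
    calc 1 / 2 * (1 - 4 * x) ≤ Real.exp (-Real.log 2) * Real.exp (-(4 * x)) := by
          rw [hhalf]
          gcongr
          exact Real.one_sub_le_exp_neg _
      _ = Real.exp (-(Real.log 2 + 4 * x)) := by rw [← Real.exp_add]; ring_nf
      _ ≤ Real.exp (-(s * x * (1 + 2 * x))) := by
          gcongr
          nlinarith
      _ = (Real.exp (-(x + 2 * x ^ 2))) ^ s := by rw [← Real.exp_nat_mul]; ring_nf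
      _ ≤ (1 - x) ^ s := by gcongr
  nlinarith

end Blocks

theorem isBooleanValued_tribesFun (w s : ℕ) : IsBooleanValued (TribesFun w s) := fun x => by
  unfold TribesFun
  split_ifs <;> simp

/-- The low degree forces `(9w)^d` to be at most a small power of `2^w`. -/
theorem degree_mul_log_le {w n : ℕ} (hw : 1000 ≤ w) (hn : (2 : ℝ) ^ w ≤ n)
    (hn' : (n : ℝ) ≤ 2 ^ w * w) :
    (⌊1 / 100 * Real.log n / Real.log (Real.log n)⌋₊ : ℝ) * Real.log (9 * w) +
      2 / 3 * Real.log n ≤ w * Real.log 2 := by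
  have hw' : (1000 : ℝ) ≤ w := by exact_mod_cast hw
  have hw0 : (0 : ℝ) < w := by linarith
  have h2 := Real.log_two_gt_d9
  have h2' := Real.log_two_lt_d9
  have hn0 : (0 : ℝ) < n := lt_of_lt_of_le (by positivity) hn
  have hlogw : Real.log w ≤ w / 10 := by
    have h20 := Real.log_le_sub_one_of_pos (show (0 : ℝ) < 20 by norm_num)
    have hw20 := Real.log_le_sub_one_of_pos (show (0 : ℝ) < w / 20 by positivity)
    rw [Real.log_div hw0.ne' (by norm_num)] at hw20
    linarith
  have hlog9 : Real.log 9 ≤ Real.log w := Real.log_le_log (by norm_num) (by linarith)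
  have hlog4 : 2 * Real.log 2 ≤ Real.log 9 := by
    rw [← Real.log_rpow two_pos]
    exact Real.log_le_log (by positivity) (by norm_num)
  have hlow : w * Real.log 2 ≤ Real.log n := by
    rw [← Real.log_pow]
    exact Real.log_le_log (by positivity) hn
  have hup : Real.log n ≤ w * Real.log 2 + Real.log w := by
    rw [← Real.log_pow, ← Real.log_mul (by positivity) hw0.ne']
    exact Real.log_le_log hn0 hn'
  have hloglog : Real.log w / 2 ≤ Real.log (Real.log n) := by
    calc Real.log w / 2 ≤ Real.log w - Real.log 2 := by linarith
      _ = Real.log (w / 2) := (Real.log_div hw0.ne' two_ne_zero).symm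
      _ ≤ Real.log (Real.log n) := Real.log_le_log (by positivity) (by nlinarith)
  have hlogw0 : 0 < Real.log w := by linarith
  have hlogn : Real.log n ≤ 2 * w := by nlinarith
  have hlogn0 : 0 ≤ Real.log n := le_trans (by positivity) hlow
  have hd : (⌊1 / 100 * Real.log n / Real.log (Real.log n)⌋₊ : ℝ) ≤
      1 / 100 * (2 * w) / (Real.log w / 2) := by
    refine (Nat.floor_le (div_nonneg (by positivity) (by linarith))).trans ?_
    gcongr
  have h9w : Real.log (9 * w) ≤ 2 * Real.log w := by
    rw [Real.log_mul (by norm_num) hw0.ne']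
    linarith
  have hprod : (⌊1 / 100 * Real.log n / Real.log (Real.log n)⌋₊ : ℝ) * Real.log (9 * w) ≤
      2 / 25 * w := by
    calc _ ≤ 1 / 100 * (2 * w) / (Real.log w / 2) * (2 * Real.log w) := by
          gcongr
          exact Real.log_nonneg (by linarith)
      _ = 2 / 25 * w := by field_simp; norm_num
  nlinarith

/-- **Tribes is approximately resilient.** There are universal constants `c, C > 0` and `w₀`
such that for every `w ≥ w₀`, with `s = ⌈(ln 2)·2^w⌉` and `n = sw`, the function `Tribes_{w,s}`
is `α`-approximately `d`-resilient with `α ≤ C·n^{-1/3}` and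
`d = ⌊c·(log n)/(log log n)⌋`. -/
theorem stmt6 :
    ∃ c : ℝ, 0 < c ∧ ∃ C : ℝ, 0 < C ∧ ∃ w₀ : ℕ,
      ∀ w : ℕ, w₀ ≤ w → ∀ s n : ℕ, s = ⌈Real.log 2 * 2 ^ w⌉₊ → n = s * w →
        ApproxResilient (C * (n : ℝ) ^ (-(1 : ℝ) / 3))
          ⌊c * Real.log n / Real.log (Real.log n)⌋₊
          (TribesFun w s) := by
  refine ⟨1 / 100, by norm_num, 10, by norm_num, 1000, ?_⟩
  rintro w hw s n hs hn
  have hwR : (1000 : ℝ) ≤ w := by exact_mod_cast hw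
  have hlog := Real.log_two_gt_d9
  have hlog' := Real.log_two_lt_d9
  have hpow : (0 : ℝ) < 2 ^ w := by positivity
  have hx : ((1 : ℝ) / 2) ^ w = (2 ^ w)⁻¹ := by rw [one_div, inv_pow]
  have hx0 : (0 : ℝ) < (1 / 2) ^ w := by positivity
  have hx1 : ((1 : ℝ) / 2) ^ w ≤ 1 / 2 :=
    pow_le_of_le_one (by norm_num) (by norm_num) (by omega)
  have hs1 : Real.log 2 * 2 ^ w ≤ s := hs ▸ Nat.le_ceil _
  have hs2 : (s : ℝ) ≤ Real.log 2 * 2 ^ w + 1 := by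
    rw [hs]
    exact (Nat.ceil_lt_add_one (by positivity)).le
  have hs3 : (s : ℝ) ≤ 2 ^ w := by
    have : s ≤ 2 ^ w := by
      rw [hs, Nat.ceil_le]
      push_cast
      nlinarith
    exact_mod_cast this
  have hsx1 : Real.log 2 ≤ s * (1 / 2) ^ w := by
    rwa [hx, ← div_eq_mul_inv, le_div_iff₀ hpow]
  have hsx2 : s * (1 / 2) ^ w ≤ Real.log 2 + (1 / 2) ^ w := by
    rw [hx, ← div_eq_mul_inv, div_le_iff₀ hpow, add_mul, inv_mul_cancel₀ hpow.ne']
    exact hs2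
  have hsx3 : (s : ℝ) * (1 / 2) ^ w ≤ 1 := by
    rw [hx, ← div_eq_mul_inv, div_le_one hpow]
    exact hs3
  have hnR : (n : ℝ) = s * w := by rw [hn]; push_cast; rfl
  have hn1 : (2 : ℝ) ^ w ≤ n := by
    rw [hnR]
    nlinarith
  have hn2 : (n : ℝ) ≤ 2 ^ w * w := by
    rw [hnR]
    gcongr
  have hn0 : (0 : ℝ) < n := hpow.trans_le hn1
  have hdeg := degree_mul_log_le hw hn1 hn2
  set d := ⌊1 / 100 * Real.log n / Real.log (Real.log n)⌋₊
  refine approxResilient_of_lowDegreeWeight_le (isBooleanValued_tribesFun w s) (by positivity) ?_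
  have hW := lowDegreeWeight_tribesFun_le (by omega : 1 ≤ w) d hsx3
  have hbal := one_sub_two_mul_pow_sq_le hx0 hx1 hsx1 hsx2
  have hwd : (1 : ℝ) ≤ w ^ d := one_le_pow₀ (by linarith)
  have hmain : ((9 : ℝ) * w) ^ d * (1 / 2) ^ w ≤ ((n : ℝ) ^ (-(1 : ℝ) / 3)) ^ 2 := by
    rw [← Real.rpow_natCast ((n : ℝ) ^ _) 2, ← Real.rpow_mul hn0.le,
      ← Real.log_le_log_iff (by positivity) (by positivity),
      Real.log_mul (by positivity) hx0.ne', Real.log_pow, Real.log_rpow hn0, hx, Real.log_inv,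
      Real.log_pow]
    push_cast
    linarith
  calc 4 * 9 ^ d * ∑ S : Finset (Fin s × Fin w) with S.card ≤ d, fcoef (TribesFun w s) S ^ 2
      ≤ 4 * 9 ^ d * (16 * (w ^ d * (1 / 2) ^ w) + 8 * w ^ d * (1 / 2) ^ w) := by
        gcongr
        refine hW.trans ?_
        gcongr
        refine hbal.trans ?_
        gcongr
        exact le_mul_of_one_le_left hx0.le hwd
    _ = 96 * ((9 * w) ^ d * (1 / 2) ^ w) := by rw [mul_pow]; ring
    _ ≤ 100 * ((n : ℝ) ^ (-(1 : ℝ) / 3)) ^ 2 := by gcongr; norm_num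
    _ = (10 * (n : ℝ) ^ (-(1 : ℝ) / 3)) ^ 2 := by ring
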